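/- (Corollary, consistency of the Laplace-approximated Bayes factor.) Under the consistency setup, let T be nonempty, let γ ⊆ {1,…,p} be nonempty with γ ≠ T, and fix a real number ν < 1. Then the ratio of approximated Bayes factors tends to zero in probability: for every δ > 0, lim_{n→∞} 𝒫( R_γ² and R_T² both lie in (0,1) and [φ(q_γ−ν, 1−R_γ²)/φ(q_T−ν, 1−R_T²)]^{1/2} · n^{(q_T − q_γ)/2} ((1 − R_T²)/(1 − R_γ²))^{n/2} ≤ δ ) = 1, where φ(s,r) = r · s^{s−1} · ((1/r − 1)·e)^{−s}. -/

import Mathlib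

open MeasureTheory Matrix Filter ENNReal

/-- The submatrix of `X` consisting of the columns indexed by `γ`. -/
noncomputable def designSub {n p : ℕ} (X : Matrix (Fin n) (Fin p) ℝ)
    (γ : Finset (Fin p)) : Matrix (Fin n) {j // j ∈ γ} ℝ :=
  Matrix.of fun i j => X i (j : Fin p)

/-- The residual projector `Q_γ = I - X_γ(X_γᵀX_γ)⁻¹X_γᵀ` of the submodel `γ`. -/
noncomputable def residProj {n p : ℕ} (X : Matrix (Fin n) (Fin p) ℝ)
    (γ : Finset (Fin p)) : Matrix (Fin n) (Fin n) ℝ :=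
  1 - designSub X γ * ((designSub X γ)ᵀ * designSub X γ)⁻¹ * (designSub X γ)ᵀ

/-- The coefficient of determination
`R_γ² = 1 - ‖Q_γ(y-ȳ1)‖²/‖y-ȳ1‖²` of the submodel `γ`. -/
noncomputable def RsqC {n p : ℕ} (X : Matrix (Fin n) (Fin p) ℝ) (γ : Finset (Fin p))
    (y : Fin n → ℝ) : ℝ :=
  1 - (∑ i, ((residProj X γ).mulVec (fun j => y j - (∑ l, y l) / n) i) ^ 2)
      / (∑ i, (y i - (∑ l, y l) / n) ^ 2)

/-- The response `y = α_T 1 + X β_T + σ_T ε` of the true model. -/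
noncomputable def yResp {n p : ℕ} (X : Matrix (Fin n) (Fin p) ℝ) (αT : ℝ)
    (βT : Fin p → ℝ) (σT : ℝ) (ε : Fin n → ℝ) : Fin n → ℝ :=
  fun i => αT + X.mulVec βT i + σT * ε i

/-- `φ(s,r) = r·s^{s-1}·((1/r-1)e)^{-s}`. -/
noncomputable def phiFun (s r : ℝ) : ℝ :=
  r * s ^ (s - 1) * ((1 / r - 1) * Real.exp 1) ^ (-s)

section Reflection
variable {n : ℕ}

/-- The reflection of `ℝⁿ` in the hyperplane orthogonal to the unit vector `w`. -/
noncomputable def reflectionMatrix (w : Fin n → ℝ) : Matrix (Fin n) (Fin n) ℝ :=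
  1 - (2 : ℝ) • vecMulVec w w

lemma reflectionMatrix_mulVec (w x : Fin n → ℝ) :
    reflectionMatrix w *ᵥ x = x - (2 * (w ⬝ᵥ x)) • w := by
  ext i
  simp [reflectionMatrix, sub_mulVec, smul_mulVec, vecMulVec_mulVec]
  ring

lemma reflectionMatrix_transpose_mul_self {w : Fin n → ℝ} (hw : w ⬝ᵥ w = 1) :
    (reflectionMatrix w)ᵀ * reflectionMatrix w = 1 := by
  have h : (reflectionMatrix w)ᵀ = reflectionMatrix w := by
    simp [reflectionMatrix, transpose_vecMulVec]
  rw [h]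
  have h2 : vecMulVec w w * vecMulVec w w = vecMulVec w w := by
    rw [vecMulVec_mul_vecMulVec, hw]; simp
  simp only [reflectionMatrix, sub_mul, mul_sub, one_mul, mul_one, smul_mul_assoc,
    mul_smul_comm, h2]
  module

/-- Two unit vectors are exchanged by an orthogonal matrix, here in functional form. -/
lemma exists_orthogonal_apply_eq_dotProduct (i : Fin n) {u : Fin n → ℝ} (hu : u ⬝ᵥ u = 1) :
    ∃ O : Matrix (Fin n) (Fin n) ℝ, Oᵀ * O = 1 ∧ ∀ x, (O *ᵥ x) i = u ⬝ᵥ x := by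
  by_cases h : u = Pi.single i 1
  · exact ⟨1, by simp, fun x => by simp [h]⟩
  set d := u - Pi.single i 1 with hd
  have hdd : d ⬝ᵥ d = 2 - 2 * u i := by
    simp [hd, sub_dotProduct, dotProduct_sub, hu]; ring
  have hpos : 0 < d ⬝ᵥ d := by
    have h0 : d ⬝ᵥ d ≠ 0 := by
      rw [Ne, dotProduct_self_eq_zero]; exact sub_ne_zero.2 h
    have h1 : 0 ≤ d ⬝ᵥ d := Finset.sum_nonneg fun j _ => mul_self_nonneg _
    exact lt_of_le_of_ne h1 h0.symm
  have hw : ((√(d ⬝ᵥ d))⁻¹ • d) ⬝ᵥ ((√(d ⬝ᵥ d))⁻¹ • d) = 1 := by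
    simp only [smul_dotProduct, dotProduct_smul, smul_eq_mul]
    rw [← mul_assoc, ← mul_inv, Real.mul_self_sqrt hpos.le, inv_mul_cancel₀ hpos.ne']
  refine ⟨_, reflectionMatrix_transpose_mul_self hw, fun x => ?_⟩
  have hdi : d i = u i - 1 := by simp [hd]
  have hdx : d ⬝ᵥ x = u ⬝ᵥ x - x i := by simp [hd, sub_dotProduct]
  have hs : (√(d ⬝ᵥ d))⁻¹ * (√(d ⬝ᵥ d))⁻¹ = (d ⬝ᵥ d)⁻¹ := by
    rw [← mul_inv, Real.mul_self_sqrt hpos.le]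
  rw [reflectionMatrix_mulVec]
  simp only [smul_dotProduct, Pi.sub_apply, Pi.smul_apply, smul_eq_mul]
  rw [show x i - 2 * ((√(d ⬝ᵥ d))⁻¹ * (d ⬝ᵥ x)) * ((√(d ⬝ᵥ d))⁻¹ * d i) =
    x i - 2 * (d ⬝ᵥ x) * d i * ((√(d ⬝ᵥ d))⁻¹ * (√(d ⬝ᵥ d))⁻¹) by ring, hs, hdi, hdx]
  rw [hdd] at hpos ⊢
  have : 1 - u i ≠ 0 := by intro h; linarith
  field_simp
  ring

end Reflection

section Spherical
variable {Ω : Type*} [MeasurableSpace Ω] {P : Measure Ω} {n : ℕ} {Z : Ω → Fin n → ℝ}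

lemma memLp_two_of_cov (hZ : Measurable Z)
    (hcov : ∀ i j, ∫ ω, Z ω i * Z ω j ∂P = if i = j then 1 else 0) (i : Fin n) :
    MemLp (fun ω => Z ω i) 2 P := by
  rw [memLp_two_iff_integrable_sq (by fun_prop)]
  by_contra h
  have h1 := hcov i i
  simp only [← sq] at h1
  rw [integral_undef h] at h1
  simp at h1

lemma memLp_two_dotProduct (hL : ∀ i, MemLp (fun ω => Z ω i) 2 P) (a : Fin n → ℝ) :
    MemLp (fun ω => a ⬝ᵥ Z ω) 2 P := by
  simp only [dotProduct]
  exact memLp_finsetSum _ fun i _ => (hL i).const_mul (a i)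

lemma integral_dotProduct_sq (hZ : Measurable Z)
    (hcov : ∀ i j, ∫ ω, Z ω i * Z ω j ∂P = if i = j then 1 else 0) (a : Fin n → ℝ) :
    ∫ ω, (a ⬝ᵥ Z ω) ^ 2 ∂P = a ⬝ᵥ a := by
  have hL := memLp_two_of_cov hZ hcov
  have hi : ∀ i j, Integrable (fun ω => a i * Z ω i * (a j * Z ω j)) P := fun i j =>
    ((hL i).const_mul (a i)).integrable_mul ((hL j).const_mul (a j))
  simp only [dotProduct, sq, Finset.sum_mul_sum]
  rw [integral_finsetSum _ fun i _ => integrable_finsetSum _ fun j _ => hi i j]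
  refine Finset.sum_congr rfl fun i _ => ?_
  rw [integral_finsetSum _ fun j _ => hi i j]
  have : ∀ j, ∫ ω, a i * Z ω i * (a j * Z ω j) ∂P = a i * a j * if i = j then 1 else 0 := by
    intro j
    rw [← hcov i j, ← integral_const_mul]
    congr 1; ext ω; ring
  simp [this]

/-- Markov's inequality for the squared norm of a linear image of an isotropic vector. -/
lemma measureReal_le_sum_mulVec_sq [IsFiniteMeasure P] (hZ : Measurable Z)
    (hcov : ∀ i j, ∫ ω, Z ω i * Z ω j ∂P = if i = j then 1 else 0)
    {k : Type*} [Fintype k] (A : Matrix k (Fin n) ℝ) {K : ℝ} (hK : 0 < K) :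
    P.real {ω | K ≤ ∑ i, (A *ᵥ Z ω) i ^ 2} ≤ (∑ i, ∑ j, A i j ^ 2) / K := by
  have hL := memLp_two_of_cov hZ hcov
  have hint : ∀ i, Integrable (fun ω => (A *ᵥ Z ω) i ^ 2) P := fun i =>
    (memLp_two_dotProduct hL (A i)).integrable_sq
  have h := mul_meas_ge_le_integral_of_nonneg (μ := P)
    (f := fun ω => ∑ i, (A *ᵥ Z ω) i ^ 2)
    (ae_of_all _ fun ω => Finset.sum_nonneg fun i _ => sq_nonneg _)
    (integrable_finsetSum _ fun i _ => hint i) K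
  rw [integral_finsetSum _ fun i _ => hint i] at h
  have h2 : ∀ i, ∫ ω, (A *ᵥ Z ω) i ^ 2 ∂P = ∑ j, A i j ^ 2 := fun i => by
    rw [show (∑ j, A i j ^ 2) = A i ⬝ᵥ A i by simp [dotProduct, sq]]
    exact integral_dotProduct_sq hZ hcov (A i)
  simp only [h2] at h
  rw [le_div_iff₀ hK, mul_comm]
  exact h

lemma measureReal_le_dotProduct_sq [IsFiniteMeasure P] (hZ : Measurable Z)
    (hcov : ∀ i j, ∫ ω, Z ω i * Z ω j ∂P = if i = j then 1 else 0)
    (a : Fin n → ℝ) {K : ℝ} (hK : 0 < K) :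
    P.real {ω | K ≤ (a ⬝ᵥ Z ω) ^ 2} ≤ (a ⬝ᵥ a) / K := by
  have h := measureReal_le_sum_mulVec_sq (P := P) hZ hcov (Matrix.of fun _ : Unit => a) hK
  simpa [mulVec, dotProduct, sq] using h

/-- Stein's identity for two coordinates of a spherically symmetric vector. -/
lemma integral_mul_eq_integral_sq_mul_deriv (hZ : Measurable Z)
    (hsph : ∀ O : Matrix (Fin n) (Fin n) ℝ, Oᵀ * O = 1 →
      P.map (fun ω => O *ᵥ Z ω) = P.map Z) [IsFiniteMeasure P]
    (hL : ∀ i, MemLp (fun ω => Z ω i) 2 P) {i j : Fin n} (hij : i ≠ j)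
    {h h' : ℝ → ℝ} (hd : ∀ x, HasDerivAt h (h' x) x) (hm : Measurable h')
    {B B' : ℝ} (hB : ∀ x, |h x| ≤ B) (hB' : ∀ x, |h' x| ≤ B') :
    ∫ ω, Z ω i * h (Z ω i) ∂P = ∫ ω, Z ω j ^ 2 * h' (Z ω i) ∂P := by
  have hc : Continuous h := continuous_iff_continuousAt.2 fun x => (hd x).continuousAt
  have hB0 : 0 ≤ B := (abs_nonneg _).trans (hB 0)
  have hB0' : 0 ≤ B' := (abs_nonneg _).trans (hB' 0)
  set F : ℝ → Ω → ℝ := fun θ ω =>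
    (Real.sin θ * Z ω i - Real.cos θ * Z ω j) * h (Real.cos θ * Z ω i + Real.sin θ * Z ω j) with hF
  set F' : ℝ → Ω → ℝ := fun θ ω =>
    (Real.cos θ * Z ω i + Real.sin θ * Z ω j) * h (Real.cos θ * Z ω i + Real.sin θ * Z ω j) -
      (Real.sin θ * Z ω i - Real.cos θ * Z ω j) ^ 2 *
        h' (Real.cos θ * Z ω i + Real.sin θ * Z ω j) with hF'
  have hconst : ∀ θ, ∫ ω, F θ ω ∂P = ∫ ω, Z ω j * h (Z ω i) ∂P := by
    intro θ
    set w : Fin n → ℝ := Real.cos (θ / 2) • Pi.single j 1 - Real.sin (θ / 2) • Pi.single i 1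
      with hw
    have hww : w ⬝ᵥ w = 1 := by
      simp [hw, dotProduct_sub, hij, hij.symm]
      nlinarith [Real.sin_sq_add_cos_sq (θ / 2)]
    have hs : Real.sin θ = 2 * Real.sin (θ / 2) * Real.cos (θ / 2) := by
      rw [← Real.sin_two_mul]; ring_nf
    have hco : Real.cos θ = 2 * Real.cos (θ / 2) ^ 2 - 1 := by
      rw [← Real.cos_two_mul]; ring_nf
    have hsc := Real.sin_sq_add_cos_sq (θ / 2)
    have hmeasf : Measurable fun x : Fin n → ℝ => x j * h (x i) := by fun_prop
    have hOm : Measurable fun ω => reflectionMatrix w *ᵥ Z ω := by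
      refine measurable_pi_iff.2 fun k => ?_
      simp only [mulVec, dotProduct]
      fun_prop
    have e1 := integral_map (μ := P) hOm.aemeasurable hmeasf.aestronglyMeasurable
    have e2 := integral_map (μ := P) hZ.aemeasurable hmeasf.aestronglyMeasurable
    rw [hsph _ (reflectionMatrix_transpose_mul_self hww), e2] at e1
    rw [e1]
    refine integral_congr_ae (ae_of_all _ fun ω => ?_)
    have hi : (reflectionMatrix w *ᵥ Z ω) i = Real.cos θ * Z ω i + Real.sin θ * Z ω j := by
      rw [reflectionMatrix_mulVec, hs, hco]
      simp [hw, sub_dotProduct, hij]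
      linear_combination (-2 * Z ω i) * hsc
    have hj : (reflectionMatrix w *ᵥ Z ω) j = Real.sin θ * Z ω i - Real.cos θ * Z ω j := by
      rw [reflectionMatrix_mulVec, hs, hco]
      simp [hw, sub_dotProduct, hij.symm]
      ring
    simp only [hF, hi, hj]
  have habs : ∀ θ x y : ℝ, |Real.cos θ * x + Real.sin θ * y| ≤ |x| + |y| ∧
      |Real.sin θ * x - Real.cos θ * y| ≤ |x| + |y| := by
    intro θ x y
    have h1 : ∀ x, |Real.cos θ * x| ≤ |x| := fun x => by
      rw [abs_mul]; exact mul_le_of_le_one_left (abs_nonneg _) (Real.abs_cos_le_one θ)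
    have h2 : ∀ x, |Real.sin θ * x| ≤ |x| := fun x => by
      rw [abs_mul]; exact mul_le_of_le_one_left (abs_nonneg _) (Real.abs_sin_le_one θ)
    exact ⟨(abs_add_le _ _).trans (add_le_add (h1 x) (h2 y)),
      (abs_sub _ _).trans (add_le_add (h2 x) (h1 y))⟩
  have hLs : MemLp (fun ω => |Z ω i| + |Z ω j|) 2 P := (hL i).abs.add (hL j).abs
  have hI1 : Integrable (fun ω => |Z ω i| + |Z ω j|) P := hLs.integrable one_le_two
  have hFd : ∀ ω θ, HasDerivAt (fun θ => F θ ω) (F' θ ω) θ := by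
    intro ω θ
    have d1 : HasDerivAt (fun θ => Real.cos θ * Z ω i + Real.sin θ * Z ω j)
        (-Real.sin θ * Z ω i + Real.cos θ * Z ω j) θ :=
      ((Real.hasDerivAt_cos θ).mul_const _).add ((Real.hasDerivAt_sin θ).mul_const _)
    have d2 : HasDerivAt (fun θ => Real.sin θ * Z ω i - Real.cos θ * Z ω j)
        (Real.cos θ * Z ω i - -Real.sin θ * Z ω j) θ :=
      ((Real.hasDerivAt_sin θ).mul_const _).sub ((Real.hasDerivAt_cos θ).mul_const _)
    refine (d2.mul ((hd _).comp θ d1)).congr_deriv ?_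
    simp only [hF', Function.comp_apply]
    ring
  have hder := hasDerivAt_integral_of_dominated_loc_of_deriv_le (μ := P) (F := F) (F' := F')
    (x₀ := 0) (s := Set.univ)
    (bound := fun ω => (|Z ω i| + |Z ω j|) * B + (|Z ω i| + |Z ω j|) ^ 2 * B')
    Filter.univ_mem
    (Filter.Eventually.of_forall fun θ => by
      apply Measurable.aestronglyMeasurable; simp only [hF]; fun_prop)
    (by
      refine (hI1.mul_const B).mono' (by
        apply Measurable.aestronglyMeasurable; simp only [hF]; fun_prop)
        (ae_of_all _ fun ω => ?_)
      simp only [hF, norm_mul, Real.norm_eq_abs]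
      exact mul_le_mul (habs 0 _ _).2 (hB _) (abs_nonneg _) (by positivity))
    (by apply Measurable.aestronglyMeasurable; simp only [hF']; fun_prop)
    (ae_of_all _ fun ω θ _ => by
      simp only [hF', Real.norm_eq_abs]
      refine (abs_sub _ _).trans (add_le_add ?_ ?_)
      · rw [abs_mul]
        exact mul_le_mul (habs θ _ _).1 (hB _) (abs_nonneg _) (by positivity)
      · rw [abs_mul, abs_pow]
        exact mul_le_mul (pow_le_pow_left₀ (abs_nonneg _) (habs θ _ _).2 2) (hB' _)
          (abs_nonneg _) (by positivity))
    ((hI1.mul_const B).add (hLs.integrable_sq.mul_const B'))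
    (ae_of_all _ fun ω θ _ => hFd ω θ)
  have hz : ∫ ω, F' 0 ω ∂P = 0 := by
    refine hder.2.unique ?_
    have : (fun θ => ∫ ω, F θ ω ∂P) = fun _ => ∫ ω, Z ω j * h (Z ω i) ∂P := funext hconst
    rw [this]
    exact hasDerivAt_const _ _
  have hia : Integrable (fun ω => Z ω i * h (Z ω i)) P := by
    refine (((hL i).integrable one_le_two).abs.mul_const B).mono' (by
      apply Measurable.aestronglyMeasurable; fun_prop) (ae_of_all _ fun ω => ?_)
    simp only [norm_mul, Real.norm_eq_abs]
    exact mul_le_mul_of_nonneg_left (hB _) (abs_nonneg _)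
  have hib : Integrable (fun ω => Z ω j ^ 2 * h' (Z ω i)) P := by
    refine ((hL j).integrable_sq.mul_const B').mono' (by
      apply Measurable.aestronglyMeasurable; fun_prop) (ae_of_all _ fun ω => ?_)
    simp only [norm_mul, Real.norm_eq_abs, abs_pow, sq_abs]
    exact mul_le_mul_of_nonneg_left (hB' _) (sq_nonneg _)
  have : ∀ ω, F' 0 ω = Z ω i * h (Z ω i) - Z ω j ^ 2 * h' (Z ω i) := fun ω => by simp [hF']
  simp only [this] at hz
  rw [integral_sub hia hib] at hz
  linarith

/-- Anti-concentration of one coordinate of a spherically symmetric vector. -/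
lemma measureReal_abs_apply_sub_le [IsProbabilityMeasure P] (hZ : Measurable Z)
    (hsph : ∀ O : Matrix (Fin n) (Fin n) ℝ, Oᵀ * O = 1 →
      P.map (fun ω => O *ᵥ Z ω) = P.map Z)
    (hcov : ∀ i j, ∫ ω, Z ω i * Z ω j ∂P = if i = j then 1 else 0) (i : Fin n) (a : ℝ)
    {t M : ℝ} (ht : 0 < t) (hM : 0 < M) :
    P.real {ω | |Z ω i - a| ≤ t} ≤
      P.real {ω | ¬ M⁻¹ < (∑ j, Z ω j ^ 2) / n} + 2 * M / n + 8 * M * t := by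
  have hn : (0 : ℝ) < n := by exact_mod_cast i.pos
  have hL := memLp_two_of_cov hZ hcov
  set h : ℝ → ℝ := fun x => Real.arctan ((x - a) / t) with hh
  set h' : ℝ → ℝ := fun x => 1 / (1 + ((x - a) / t) ^ 2) * (1 / t) with hh'
  have hd : ∀ x, HasDerivAt h (h' x) x := fun x =>
    (((hasDerivAt_id x).sub_const a).div_const t).arctan
  have hm : Measurable h' := by simp only [hh']; fun_prop
  have hB : ∀ x, |h x| ≤ 2 := fun x => by
    rw [abs_le]
    have h1 := Real.neg_pi_div_two_lt_arctan ((x - a) / t)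
    have h2 := Real.arctan_lt_pi_div_two ((x - a) / t)
    have h3 := Real.pi_le_four
    constructor <;> simp only [hh] <;> linarith
  have hpos : ∀ x, 0 ≤ h' x := fun x => by simp only [hh']; positivity
  have hB' : ∀ x, |h' x| ≤ 1 / t := fun x => by
    rw [abs_of_nonneg (hpos x)]
    refine mul_le_of_le_one_left (by positivity) ?_
    rw [div_le_one (by positivity)]
    nlinarith [sq_nonneg ((x - a) / t)]
  have hlow : ∀ x, |x - a| ≤ t → 1 / (2 * t) ≤ h' x := fun x hx => by
    have : ((x - a) / t) ^ 2 ≤ 1 := by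
      rw [sq_le_one_iff_abs_le_one, abs_div, abs_of_pos ht, div_le_one ht]; exact hx
    simp only [hh']
    rw [div_mul_div_comm, one_mul]
    exact one_div_le_one_div_of_le (by positivity) (by nlinarith)
  have hib : ∀ j, Integrable (fun ω => Z ω j ^ 2 * h' (Z ω i)) P := fun j => by
    refine ((hL j).integrable_sq.mul_const (1 / t)).mono' (by
      apply Measurable.aestronglyMeasurable; fun_prop) (ae_of_all _ fun ω => ?_)
    simp only [norm_mul, Real.norm_eq_abs, abs_pow, sq_abs]
    exact mul_le_mul_of_nonneg_left (hB' _) (sq_nonneg _)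
  have hmean : ∫ ω, Z ω i * h (Z ω i) ∂P ≤ 2 := by
    have hi2 : Integrable (fun ω => 1 + Z ω i ^ 2) P :=
      (integrable_const _).add (hL i).integrable_sq
    have hi : Integrable (fun ω => Z ω i * h (Z ω i)) P := by
      refine (((hL i).integrable one_le_two).abs.mul_const 2).mono' (by
        apply Measurable.aestronglyMeasurable; simp only [hh]; fun_prop)
        (ae_of_all _ fun ω => ?_)
      simp only [norm_mul, Real.norm_eq_abs]
      exact mul_le_mul_of_nonneg_left (hB _) (abs_nonneg _)
    have h2 : ∫ ω, Z ω i * h (Z ω i) ∂P ≤ ∫ ω, (1 + Z ω i ^ 2) ∂P := by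
      refine integral_mono hi hi2 fun ω => ?_
      have h3 : Z ω i * h (Z ω i) ≤ |Z ω i| * 2 := (le_abs_self _).trans (by
        rw [abs_mul]; exact mul_le_mul_of_nonneg_left (hB _) (abs_nonneg _))
      nlinarith [sq_nonneg (|Z ω i| - 1), sq_abs (Z ω i)]
    rw [integral_add (integrable_const _) (hL i).integrable_sq] at h2
    have := hcov i i
    simp only [← sq] at this
    rw [this] at h2
    simp at h2
    linarith
  set S : Set Ω := {ω | |Z ω i - a| ≤ t ∧ n / (2 * M) ≤ ∑ j ∈ Finset.univ.erase i, Z ω j ^ 2}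
    with hS
  have hSm : MeasurableSet S := by
    have h1 : MeasurableSet {ω | |Z ω i - a| ≤ t} :=
      measurableSet_le (by fun_prop) measurable_const
    have h2 : MeasurableSet {ω | n / (2 * M) ≤ ∑ j ∈ Finset.univ.erase i, Z ω j ^ 2} :=
      measurableSet_le measurable_const (Finset.measurable_sum _ fun j _ => by fun_prop)
    exact h1.inter h2
  have hPS : P.real S ≤ 8 * M * t := by
    have h1 : ∫ ω, S.indicator (fun _ => n / (2 * M) * (1 / (2 * t))) ω ∂P ≤
        ∫ ω, ∑ j ∈ Finset.univ.erase i, Z ω j ^ 2 * h' (Z ω i) ∂P := by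
      refine integral_mono ((integrable_const _).indicator hSm)
        (integrable_finsetSum _ fun j _ => hib j) fun ω => ?_
      rw [← Finset.sum_mul]
      by_cases hω : ω ∈ S
      · rw [Set.indicator_of_mem hω]
        exact mul_le_mul hω.2 (hlow _ hω.1) (by positivity)
          (Finset.sum_nonneg fun _ _ => sq_nonneg _)
      · rw [Set.indicator_of_notMem hω]
        exact mul_nonneg (Finset.sum_nonneg fun _ _ => sq_nonneg _) (hpos _)
    rw [integral_indicator_const _ hSm, integral_finsetSum _ fun j _ => hib j] at h1
    have h2 : ∀ j ∈ Finset.univ.erase i, ∫ ω, Z ω j ^ 2 * h' (Z ω i) ∂P ≤ 2 := fun j hj => by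
      rw [← integral_mul_eq_integral_sq_mul_deriv hZ hsph hL (Finset.ne_of_mem_erase hj).symm
        hd hm hB hB']
      exact hmean
    have h3 := h1.trans (Finset.sum_le_card_nsmul _ _ _ h2)
    have h4 : ((Finset.univ.erase i).card : ℝ) ≤ n := by
      exact_mod_cast (Finset.card_le_univ _).trans (by simp)
    simp only [smul_eq_mul, nsmul_eq_mul] at h3
    have h5 : P.real S * (n / (2 * M) * (1 / (2 * t))) ≤ n * 2 := by linarith
    have h6 : P.real S * (n / (2 * M) * (1 / (2 * t))) = P.real S / (8 * M * t) * (n * 2) := by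
      field_simp; ring
    rw [h6] at h5
    have h7 := le_of_mul_le_mul_right (h5.trans_eq (one_mul _).symm) (by positivity)
    rwa [div_le_one (by positivity)] at h7
  have hP2 : P.real {ω | n / (2 * M) ≤ Z ω i ^ 2} ≤ 2 * M / n := by
    have := measureReal_le_dotProduct_sq (P := P) hZ hcov (Pi.single i 1)
      (K := n / (2 * M)) (by positivity)
    simpa using this
  have hsub : {ω | |Z ω i - a| ≤ t} ⊆
      {ω | ¬ M⁻¹ < (∑ j, Z ω j ^ 2) / n} ∪ {ω | n / (2 * M) ≤ Z ω i ^ 2} ∪ S := by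
    intro ω hω
    by_contra hcon
    simp only [Set.mem_union, Set.mem_ofPred_eq, not_or, not_not, not_le] at hcon
    obtain ⟨⟨h1, h2⟩, h3⟩ := hcon
    refine h3 ⟨hω, ?_⟩
    rw [lt_div_iff₀ hn, ← Finset.add_sum_erase _ _ (Finset.mem_univ i)] at h1
    have : M⁻¹ * n = n / (2 * M) + n / (2 * M) := by field_simp; ring
    linarith
  calc _ ≤ _ := measureReal_mono hsub
    _ ≤ _ := measureReal_union_le _ _
    _ ≤ _ := add_le_add (measureReal_union_le _ _) hPS
    _ ≤ _ := by linarith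

/-- Anti-concentration of a spherically symmetric vector in the direction of a unit vector. -/
lemma measureReal_abs_dotProduct_sub_le [IsProbabilityMeasure P] (hZ : Measurable Z)
    (hsph : ∀ O : Matrix (Fin n) (Fin n) ℝ, Oᵀ * O = 1 →
      P.map (fun ω => O *ᵥ Z ω) = P.map Z)
    (hcov : ∀ i j, ∫ ω, Z ω i * Z ω j ∂P = if i = j then 1 else 0) (hn : 0 < n)
    {u : Fin n → ℝ} (hu : u ⬝ᵥ u = 1) (a : ℝ) {t M : ℝ} (ht : 0 < t) (hM : 0 < M) :
    P.real {ω | |u ⬝ᵥ Z ω - a| ≤ t} ≤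
      P.real {ω | ¬ M⁻¹ < (∑ j, Z ω j ^ 2) / n} + 2 * M / n + 8 * M * t := by
  refine le_of_eq_of_le ?_ (measureReal_abs_apply_sub_le hZ hsph hcov ⟨0, hn⟩ a ht hM)
  obtain ⟨O, hO, hOu⟩ := exists_orthogonal_apply_eq_dotProduct ⟨0, hn⟩ hu
  have hS : MeasurableSet {x : Fin n → ℝ | |x ⟨0, hn⟩ - a| ≤ t} :=
    measurableSet_le (by fun_prop) measurable_const
  have hOm : Measurable fun ω => O *ᵥ Z ω := by
    refine measurable_pi_iff.2 fun k => ?_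
    simp only [mulVec, dotProduct]
    fun_prop
  have e := congrArg (fun μ : Measure (Fin n → ℝ) => μ.real {x | |x ⟨0, hn⟩ - a| ≤ t}) (hsph O hO)
  simp only [map_measureReal_apply hOm hS, map_measureReal_apply hZ hS] at e
  simpa only [Set.preimage_ofPred_eq, hOu] using e

end Spherical

section Hat
variable {n p : ℕ} {X : Matrix (Fin n) (Fin p) ℝ} {γ : Finset (Fin p)}

/-- The orthogonal projector `X_γ(X_γᵀX_γ)⁻¹X_γᵀ` onto the column space of `X_γ`. -/
noncomputable def hatMatrix (X : Matrix (Fin n) (Fin p) ℝ) (γ : Finset (Fin p)) :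
    Matrix (Fin n) (Fin n) ℝ :=
  designSub X γ * ((designSub X γ)ᵀ * designSub X γ)⁻¹ * (designSub X γ)ᵀ

lemma hatMatrix_transpose : (hatMatrix X γ)ᵀ = hatMatrix X γ := by
  simp [hatMatrix, transpose_mul, transpose_nonsing_inv, Matrix.mul_assoc]

lemma hatMatrix_mul_designSub (h : IsUnit ((designSub X γ)ᵀ * designSub X γ).det) :
    hatMatrix X γ * designSub X γ = designSub X γ := by
  rw [hatMatrix, Matrix.mul_assoc, Matrix.mul_assoc, nonsing_inv_mul _ h, Matrix.mul_one]

lemma hatMatrix_mul_self (h : IsUnit ((designSub X γ)ᵀ * designSub X γ).det) :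
    hatMatrix X γ * hatMatrix X γ = hatMatrix X γ := by
  nth_rewrite 2 [hatMatrix]
  rw [← Matrix.mul_assoc, ← Matrix.mul_assoc, hatMatrix_mul_designSub h, hatMatrix]

lemma sum_hatMatrix_sq (h : IsUnit ((designSub X γ)ᵀ * designSub X γ).det) :
    ∑ i, ∑ j, hatMatrix X γ i j ^ 2 = γ.card := by
  have h1 : ∑ i, ∑ j, hatMatrix X γ i j ^ 2 = (hatMatrix X γ * (hatMatrix X γ)ᵀ).trace := by
    simp [trace, mul_apply, sq]
  rw [h1, hatMatrix_transpose, hatMatrix_mul_self h, hatMatrix, trace_mul_comm,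
    ← Matrix.mul_assoc, mul_nonsing_inv _ h]
  simp

lemma dotProduct_hatMatrix_mulVec (x y : Fin n → ℝ) :
    x ⬝ᵥ hatMatrix X γ *ᵥ y = hatMatrix X γ *ᵥ x ⬝ᵥ y := by
  rw [dotProduct_mulVec, ← mulVec_transpose, hatMatrix_transpose]

lemma hatMatrix_mulVec_dotProduct_self (h : IsUnit ((designSub X γ)ᵀ * designSub X γ).det)
    (x y : Fin n → ℝ) :
    hatMatrix X γ *ᵥ x ⬝ᵥ hatMatrix X γ *ᵥ y = hatMatrix X γ *ᵥ x ⬝ᵥ y := by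
  rw [dotProduct_hatMatrix_mulVec, mulVec_mulVec, hatMatrix_mul_self h]

lemma designSub_mulVec (z : {j // j ∈ γ} → ℝ) :
    designSub X γ *ᵥ z = X *ᵥ fun j => if h : j ∈ γ then z ⟨j, h⟩ else 0 := by
  ext i
  simp only [mulVec, dotProduct, designSub, of_apply, mul_dite, mul_zero]
  rw [Finset.sum_dite]
  simp only [Finset.sum_const_zero, add_zero]
  exact Finset.sum_bij' (fun j _ => ⟨j.1, by simp⟩) (fun j _ => ⟨j.1, by simpa using j.2⟩)
    (by simp) (by simp) (by simp) (by simp) (by simp)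

lemma hatMatrix_mulVec_of_support (h : IsUnit ((designSub X γ)ᵀ * designSub X γ).det)
    {β : Fin p → ℝ} (hβ : ∀ j ∉ γ, β j = 0) :
    hatMatrix X γ *ᵥ (X *ᵥ β) = X *ᵥ β := by
  have h1 : X *ᵥ β = designSub X γ *ᵥ fun j => β j := by
    rw [designSub_mulVec]
    congr 1; ext j
    by_cases hj : j ∈ γ <;> simp [hj, hβ]
  rw [h1, mulVec_mulVec, hatMatrix_mul_designSub h]

lemma exists_hatMatrix_mulVec_eq (y : Fin n → ℝ) :
    ∃ β : Fin p → ℝ, (∀ j ∉ γ, β j = 0) ∧ hatMatrix X γ *ᵥ y = X *ᵥ β := by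
  rw [hatMatrix, Matrix.mul_assoc, ← mulVec_mulVec, designSub_mulVec]
  exact ⟨_, fun j hj => by simp [hj], rfl⟩

lemma hatMatrix_mulVec_one (hX : ∀ j, ∑ i, X i j = 0) : hatMatrix X γ *ᵥ 1 = 0 := by
  rw [hatMatrix, ← mulVec_mulVec]
  have : (designSub X γ)ᵀ *ᵥ 1 = 0 := by
    ext j
    simpa [mulVec, dotProduct, designSub] using hX j
  simp [this]

/-- If the Gram matrix of `X` is bounded below by `c > 0`, so is that of every submodel. -/
lemma isUnit_det_gram_designSub {c : ℝ} (hc : 0 < c)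
    (hX : ∀ β : Fin p → ℝ, c * (β ⬝ᵥ β) ≤ X *ᵥ β ⬝ᵥ X *ᵥ β) :
    IsUnit ((designSub X γ)ᵀ * designSub X γ).det := by
  rw [isUnit_iff_ne_zero]
  intro h0
  obtain ⟨z, hz, hz0⟩ := exists_mulVec_eq_zero_iff.2 h0
  have h1 : designSub X γ *ᵥ z ⬝ᵥ designSub X γ *ᵥ z = 0 := by
    rw [dotProduct_mulVec, ← mulVec_transpose, mulVec_mulVec, hz0, zero_dotProduct]
  rw [designSub_mulVec] at h1
  have h2 := hX fun j => if h : j ∈ γ then z ⟨j, h⟩ else 0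
  rw [h1] at h2
  refine hz ?_
  have h3 : (fun j => if h : j ∈ γ then z ⟨j, h⟩ else 0) ⬝ᵥ
      (fun j => if h : j ∈ γ then z ⟨j, h⟩ else 0) = (0 : ℝ) := by
    refine le_antisymm ?_ (Finset.sum_nonneg fun j _ => mul_self_nonneg _)
    by_contra hcon
    push Not at hcon
    nlinarith [mul_pos hc hcon]
  rw [dotProduct_self_eq_zero] at h3
  ext j
  simpa using congrFun h3 j.1

/-- `R_γ²` of the response, expressed through inner products of `b = Xβ` and the noise. -/
lemma RsqC_yResp (hn : 0 < n) (hX : ∀ j, ∑ i, X i j = 0)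
    (h : IsUnit ((designSub X γ)ᵀ * designSub X γ).det) (α σ : ℝ) (β : Fin p → ℝ)
    (e : Fin n → ℝ) :
    RsqC X γ (yResp X α β σ e) =
      1 - ((X *ᵥ β ⬝ᵥ X *ᵥ β + 2 * σ * (X *ᵥ β ⬝ᵥ e) + σ ^ 2 * (e ⬝ᵥ e - (∑ i, e i) ^ 2 / n)) -
        (hatMatrix X γ *ᵥ (X *ᵥ β) ⬝ᵥ hatMatrix X γ *ᵥ (X *ᵥ β) +
          2 * σ * (hatMatrix X γ *ᵥ (X *ᵥ β) ⬝ᵥ e) +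
          σ ^ 2 * (hatMatrix X γ *ᵥ e ⬝ᵥ hatMatrix X γ *ᵥ e))) /
        (X *ᵥ β ⬝ᵥ X *ᵥ β + 2 * σ * (X *ᵥ β ⬝ᵥ e) +
          σ ^ 2 * (e ⬝ᵥ e - (∑ i, e i) ^ 2 / n)) := by
  have hn' : (n : ℝ) ≠ 0 := by positivity
  set b := X *ᵥ β with hb
  set H := hatMatrix X γ with hH
  have hb1 : b ⬝ᵥ 1 = 0 := by
    rw [hb, dotProduct_comm, dotProduct_mulVec, ← mulVec_transpose]
    have : Xᵀ *ᵥ 1 = 0 := by ext j; simpa [mulVec, dotProduct] using hX j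
    rw [this, zero_dotProduct]
  have hsb : ∑ i, b i = 0 := by simpa [dotProduct] using hb1
  set m := (∑ i, e i) / n with hm
  set w : Fin n → ℝ := b + σ • (e - m • 1) with hw
  have hcent : (fun j => yResp X α β σ e j - (∑ l, yResp X α β σ e l) / n) = w := by
    ext j
    have : ∑ l, yResp X α β σ e l = n * α + σ * ∑ i, e i := by
      simp only [yResp, Finset.sum_add_distrib, ← Finset.mul_sum]
      rw [← hb, hsb]; simp
    rw [this]
    simp [yResp, hw, ← hb, hm]
    field_simp
    ring
  have he1 : e ⬝ᵥ 1 = n * m := by simp [dotProduct, hm]; field_simp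
  have h11 : (1 : Fin n → ℝ) ⬝ᵥ 1 = n := by simp [dotProduct]
  have hww : w ⬝ᵥ w = b ⬝ᵥ b + 2 * σ * (b ⬝ᵥ e) + σ ^ 2 * (e ⬝ᵥ e - (∑ i, e i) ^ 2 / n) := by
    have hmm : (∑ i, e i) ^ 2 / n = n * m ^ 2 := by rw [hm]; field_simp
    rw [hmm]
    simp only [hw, add_dotProduct, dotProduct_add, smul_dotProduct, dotProduct_smul,
      sub_dotProduct, dotProduct_sub, smul_eq_mul, dotProduct_comm 1 e, he1, hb1, h11,
      dotProduct_comm e b, dotProduct_comm 1 b]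
    ring
  have hHw : H *ᵥ w = H *ᵥ b + σ • H *ᵥ e := by
    simp only [hw, mulVec_add, mulVec_smul, mulVec_sub, hH, hatMatrix_mulVec_one hX]
    simp
  have hHHw : H *ᵥ w ⬝ᵥ H *ᵥ w = H *ᵥ b ⬝ᵥ H *ᵥ b + 2 * σ * (H *ᵥ b ⬝ᵥ e) +
      σ ^ 2 * (H *ᵥ e ⬝ᵥ H *ᵥ e) := by
    have : H *ᵥ b ⬝ᵥ H *ᵥ e = H *ᵥ b ⬝ᵥ e := hatMatrix_mulVec_dotProduct_self h b e
    simp only [hHw, add_dotProduct, dotProduct_add, smul_dotProduct, dotProduct_smul, smul_eq_mul,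
      dotProduct_comm (H *ᵥ e) (H *ᵥ b), this]
    ring
  have hnum : ∑ i, (residProj X γ *ᵥ w) i ^ 2 = w ⬝ᵥ w - H *ᵥ w ⬝ᵥ H *ᵥ w := by
    have h1 : residProj X γ *ᵥ w = w - H *ᵥ w := by
      rw [show residProj X γ = 1 - H from rfl, sub_mulVec, one_mulVec]
    have h2 : H *ᵥ w ⬝ᵥ H *ᵥ w = H *ᵥ w ⬝ᵥ w := hatMatrix_mulVec_dotProduct_self h w w
    rw [show ∑ i, (residProj X γ *ᵥ w) i ^ 2 =
      (residProj X γ *ᵥ w) ⬝ᵥ (residProj X γ *ᵥ w) by simp [dotProduct, sq], h1]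
    simp only [sub_dotProduct, dotProduct_sub, h2, dotProduct_comm w (H *ᵥ w)]
    ring
  have hden : ∑ i, (yResp X α β σ e i - (∑ l, yResp X α β σ e l) / n) ^ 2 = w ⬝ᵥ w := by
    rw [← hcent]; simp [dotProduct, sq]
  rw [RsqC, hcent, hden, hnum, hww, hHHw]

end Hat

section Gram

lemma exists_pos_forall_mul_dotProduct_self_le {p : ℕ} {S : Matrix (Fin p) (Fin p) ℝ}
    (hS : S.PosDef) : ∃ c > 0, ∀ x : Fin p → ℝ, c * (x ⬝ᵥ x) ≤ x ⬝ᵥ S *ᵥ x := by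
  set K : Set (Fin p → ℝ) := {x | x ⬝ᵥ x = 1} with hK
  have hcont : Continuous fun x : Fin p → ℝ => x ⬝ᵥ S *ᵥ x := by
    simp only [dotProduct, mulVec]; fun_prop
  have hKc : IsCompact K := by
    refine Metric.isCompact_of_isClosed_isBounded
      (isClosed_eq (by simp only [dotProduct]; fun_prop) continuous_const) ?_
    refine (Metric.isBounded_iff_subset_closedBall 0).2 ⟨1, fun x hx => ?_⟩
    rw [mem_closedBall_zero_iff, pi_norm_le_iff_of_nonneg zero_le_one]
    intro i
    have h1 : x i * x i ≤ x ⬝ᵥ x :=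
      Finset.single_le_sum (f := fun i => x i * x i) (fun j _ => mul_self_nonneg _)
        (Finset.mem_univ i)
    rw [show x ⬝ᵥ x = 1 from hx] at h1
    rw [Real.norm_eq_abs, ← sq_le_one_iff_abs_le_one, sq]
    exact h1
  have hpos : ∀ x : Fin p → ℝ, x ≠ 0 → 0 < x ⬝ᵥ S *ᵥ x := fun x hx => by
    simpa using hS.dotProduct_mulVec_pos hx
  have hc : ∃ c > 0, ∀ x ∈ K, c ≤ x ⬝ᵥ S *ᵥ x := by
    rcases K.eq_empty_or_nonempty with he | hne
    · exact ⟨1, one_pos, by simp [he]⟩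
    obtain ⟨x, hx, hmin⟩ := hKc.exists_isMinOn hne hcont.continuousOn
    refine ⟨_, hpos x ?_, fun y hy => hmin hy⟩
    rintro rfl
    simp [hK] at hx
  obtain ⟨c, hc0, hc⟩ := hc
  refine ⟨c, hc0, fun x => ?_⟩
  have hxx : 0 ≤ x ⬝ᵥ x := Finset.sum_nonneg fun j _ => mul_self_nonneg _
  rcases hxx.eq_or_lt with h0 | h0
  · have : x = 0 := dotProduct_self_eq_zero.1 h0.symm
    simp [this]
  have hs : (√(x ⬝ᵥ x))⁻¹ * (√(x ⬝ᵥ x))⁻¹ = (x ⬝ᵥ x)⁻¹ := by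
    rw [← mul_inv, Real.mul_self_sqrt h0.le]
  have h1 := hc ((√(x ⬝ᵥ x))⁻¹ • x) (by
    simp only [hK, Set.mem_ofPred_eq, smul_dotProduct, dotProduct_smul, smul_eq_mul]
    rw [← mul_assoc, hs, inv_mul_cancel₀ h0.ne'])
  simp only [mulVec_smul, smul_dotProduct, dotProduct_smul, smul_eq_mul] at h1
  rwa [← mul_assoc, hs, ← div_eq_inv_mul, le_div_iff₀ h0] at h1

variable {p : ℕ} {X : (n : ℕ) → Matrix (Fin n) (Fin p) ℝ} {S : Matrix (Fin p) (Fin p) ℝ}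

lemma tendsto_gram_form
    (hX : Tendsto (fun n : ℕ => ((n : ℝ)⁻¹) • ((X n)ᵀ * X n)) atTop (nhds S)) (β : Fin p → ℝ) :
    Tendsto (fun n : ℕ => (X n *ᵥ β ⬝ᵥ X n *ᵥ β) / n) atTop (nhds (β ⬝ᵥ S *ᵥ β)) := by
  have hcont : Continuous fun A : Matrix (Fin p) (Fin p) ℝ => β ⬝ᵥ A *ᵥ β := by fun_prop
  refine ((hcont.tendsto S).comp hX).congr fun n => ?_
  simp only [Function.comp, smul_mulVec, dotProduct_smul, smul_eq_mul]
  rw [← mulVec_mulVec, dotProduct_mulVec β, ← mulVec_transpose, transpose_transpose]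
  ring

lemma eventually_gram_lower_bound (hS : S.PosDef)
    (hX : Tendsto (fun n : ℕ => ((n : ℝ)⁻¹) • ((X n)ᵀ * X n)) atTop (nhds S)) :
    ∃ c > 0, ∀ᶠ n : ℕ in atTop, ∀ β : Fin p → ℝ,
      c * n * (β ⬝ᵥ β) ≤ X n *ᵥ β ⬝ᵥ X n *ᵥ β := by
  obtain ⟨c, hc0, hc⟩ := exists_pos_forall_mul_dotProduct_self_le hS
  refine ⟨c / 2, by positivity, ?_⟩
  set η : ℝ := c / (2 * (p + 1)) with hη
  have hη0 : 0 < η := by positivity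
  have hent : ∀ᶠ n : ℕ in atTop, ∀ i j,
      |(((n : ℝ)⁻¹) • ((X n)ᵀ * X n)) i j - S i j| ≤ η := by
    refine eventually_all.2 fun i => eventually_all.2 fun j => ?_
    have h1 := (tendsto_pi_nhds.1 (tendsto_pi_nhds.1 hX i) j)
    filter_upwards [Metric.tendsto_nhds.1 h1 η hη0] with n hn
    exact (Real.dist_eq _ _ ▸ hn).le
  filter_upwards [hent, eventually_gt_atTop 0] with n hn hn0 β
  have hn0' : (0 : ℝ) < n := by exact_mod_cast hn0
  set G := ((n : ℝ)⁻¹) • ((X n)ᵀ * X n) with hG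
  have h1 : X n *ᵥ β ⬝ᵥ X n *ᵥ β = n * (β ⬝ᵥ G *ᵥ β) := by
    simp only [hG, smul_mulVec, dotProduct_smul, smul_eq_mul]
    rw [← mulVec_mulVec, dotProduct_mulVec β, ← mulVec_transpose, transpose_transpose]
    field_simp
  have h2 : |β ⬝ᵥ (G - S) *ᵥ β| ≤ c / 2 * (β ⬝ᵥ β) := by
    have h3 : β ⬝ᵥ (G - S) *ᵥ β = ∑ i, ∑ j, β i * ((G i j - S i j) * β j) := by
      simp [dotProduct, mulVec, Finset.mul_sum]
    have h4 : ∀ i j, |β i * ((G i j - S i j) * β j)| ≤ η * ((β i * β i + β j * β j) / 2) := by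
      intro i j
      rw [abs_mul, abs_mul, show |β i| * (|G i j - S i j| * |β j|) =
        |G i j - S i j| * (|β i| * |β j|) by ring]
      refine mul_le_mul (hn i j) ?_ (by positivity) hη0.le
      nlinarith [sq_nonneg (|β i| - |β j|), abs_mul_abs_self (β i), abs_mul_abs_self (β j)]
    rw [h3]
    calc _ ≤ ∑ i, ∑ j, η * ((β i * β i + β j * β j) / 2) :=
          (Finset.abs_sum_le_sum_abs _ _).trans (Finset.sum_le_sum fun i _ =>
            (Finset.abs_sum_le_sum_abs _ _).trans (Finset.sum_le_sum fun j _ => h4 i j))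
      _ = ∑ i, (η * p / 2 * (β i * β i) + η / 2 * (β ⬝ᵥ β)) := by
          refine Finset.sum_congr rfl fun i _ => ?_
          simp only [← Finset.mul_sum, ← Finset.sum_div, Finset.sum_add_distrib, dotProduct,
            Finset.sum_const, Finset.card_univ, Fintype.card_fin, nsmul_eq_mul]
          ring
      _ = η * p * (β ⬝ᵥ β) := by
          rw [Finset.sum_add_distrib, ← Finset.mul_sum]
          simp only [Finset.sum_const, Finset.card_univ, Fintype.card_fin, nsmul_eq_mul, dotProduct]
          ring
      _ ≤ c / 2 * (β ⬝ᵥ β) := by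
          refine mul_le_mul_of_nonneg_right ?_ (Finset.sum_nonneg fun j _ => mul_self_nonneg _)
          rw [hη, div_mul_eq_mul_div, div_le_div_iff₀ (by positivity) two_pos]
          nlinarith
  have h5 : β ⬝ᵥ G *ᵥ β = β ⬝ᵥ S *ᵥ β + β ⬝ᵥ (G - S) *ᵥ β := by
    rw [sub_mulVec, dotProduct_sub]; ring
  have h6 : c / 2 * (β ⬝ᵥ β) ≤ β ⬝ᵥ G *ᵥ β := by
    have := (abs_le.1 h2).1
    have := hc β
    linarith
  rw [h1]
  calc c / 2 * n * (β ⬝ᵥ β) = n * (c / 2 * (β ⬝ᵥ β)) := by ring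
    _ ≤ _ := mul_le_mul_of_nonneg_left h6 hn0'.le

end Gram

section Asymptotics

lemma phiFun_eq {s r : ℝ} (h0 : 0 < r) (h1 : r < 1) :
    phiFun s r = s ^ (s - 1) * Real.exp (-s) * (r ^ (1 + s) * (1 - r) ^ (-s)) := by
  have e : (1 / r - 1) * Real.exp 1 = (1 - r) * r⁻¹ * Real.exp 1 := by field_simp
  rw [phiFun, e, Real.mul_rpow (mul_nonneg (by linarith) (by positivity)) (Real.exp_pos _).le,
    Real.mul_rpow (by linarith) (by positivity), Real.exp_one_rpow, Real.inv_rpow h0.le,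
    ← Real.rpow_neg h0.le, neg_neg, Real.rpow_add h0, Real.rpow_one]
  ring

lemma phiFun_div_le {s s' c r r' ρ : ℝ} (hs : 0 < s) (hs' : 0 < s') (hc : 0 < c)
    (hr0 : 0 < r) (hr1 : r < 1) (hρ : 0 < ρ) (hr : ρ ≤ 1 - r) (hr' : c ≤ r') (hr1' : r' < 1) :
    0 ≤ phiFun s r / phiFun s' r' ∧ phiFun s r / phiFun s' r' ≤
      s ^ (s - 1) * Real.exp (-s) / (s' ^ (s' - 1) * Real.exp (-s') * c ^ (1 + s')) *
        ρ ^ (-s) := by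
  have hr0' : 0 < r' := hc.trans_le hr'
  have h1r : 0 < 1 - r := by linarith
  have h1r' : 0 < 1 - r' := by linarith
  rw [phiFun_eq hr0 hr1, phiFun_eq hr0' hr1']
  refine ⟨by positivity, ?_⟩
  rw [div_mul_eq_mul_div]
  have a1 : r ^ (1 + s) ≤ 1 := Real.rpow_le_one hr0.le hr1.le (by linarith)
  have a2 : (1 - r) ^ (-s) ≤ ρ ^ (-s) := Real.rpow_le_rpow_of_nonpos hρ hr (by linarith)
  have a3 : c ^ (1 + s') ≤ r' ^ (1 + s') := Real.rpow_le_rpow hc.le hr' (by linarith)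
  have a4 : 1 ≤ (1 - r') ^ (-s') :=
    Real.one_le_rpow_of_pos_of_le_one_of_nonpos h1r' (by linarith) (by linarith)
  have a5 : 0 < c ^ (1 + s') := by positivity
  have a6 : 0 < ρ ^ (-s) := by positivity
  gcongr
  · calc r ^ (1 + s) * (1 - r) ^ (-s) ≤ 1 * ρ ^ (-s) := by gcongr
      _ = ρ ^ (-s) := one_mul _
  · calc c ^ (1 + s') = c ^ (1 + s') * 1 := (mul_one _).symm
      _ ≤ _ := by gcongr

lemma tendsto_rpow_mul_rpow_half_atTop_zero (K s : ℝ) {η : ℝ} (h0 : 0 < η) (h1 : η < 1) :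
    Tendsto (fun n : ℕ => K * ((n : ℝ) ^ s * η ^ ((n : ℝ) / 2))) atTop (nhds 0) := by
  have hb : 0 < -Real.log η / 2 := by have := Real.log_neg h0 h1; linarith
  have h := ((tendsto_rpow_mul_exp_neg_mul_atTop_nhds_zero s _ hb).comp
    tendsto_natCast_atTop_atTop).const_mul K
  rw [mul_zero] at h
  refine h.congr fun n => ?_
  simp only [Function.comp]
  rw [Real.rpow_def_of_pos h0]
  congr 3
  ring

/-- The ratio vanishes when the residual of `γ` exceeds that of `T` by a linear amount. -/
lemma eventually_ratio_le_of_linear_gap {s s' k a d κ τ δ : ℝ} (hs : 0 < s) (hs' : 0 < s')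
    (ha : 0 < a) (hd : 0 < d) (hκ : 0 < κ) (hτ : 0 < τ) (hδ : 0 < δ) :
    ∀ᶠ n : ℕ in atTop, ∀ D N N' : ℝ, a * n ≤ N' → N' < D → D ≤ d * n → N' + κ * n ≤ N →
      τ ≤ D - N →
      0 < 1 - N / D ∧ 1 - N / D < 1 ∧ 0 < 1 - N' / D ∧ 1 - N' / D < 1 ∧
      (phiFun s (1 - (1 - N / D)) / phiFun s' (1 - (1 - N' / D))) ^ ((1:ℝ)/2) * (n : ℝ) ^ k *
        ((1 - (1 - N' / D)) / (1 - (1 - N / D))) ^ ((n : ℝ) / 2) ≤ δ := by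
  set W : ℝ := s ^ (s - 1) * Real.exp (-s) /
    (s' ^ (s' - 1) * Real.exp (-s') * (a / d) ^ (1 + s')) with hW
  have hη0 : 0 < d / (d + κ) := by positivity
  have hη1 : d / (d + κ) < 1 := by rw [div_lt_one (by positivity)]; linarith
  have hlim := tendsto_rpow_mul_rpow_half_atTop_zero
    ((W * (τ / d) ^ (-s)) ^ ((1:ℝ)/2)) (s / 2 + k) hη0 hη1
  filter_upwards [hlim.eventually_le_const hδ, eventually_gt_atTop 0] with n hn hn0
    D N N' h1 h2 h3 h4 h5
  have hnr : (0 : ℝ) < n := by exact_mod_cast hn0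
  have hN' : 0 < N' := lt_of_lt_of_le (by positivity) h1
  have hD : 0 < D := hN'.trans h2
  have hN : 0 < N := lt_of_lt_of_le (by positivity) h4
  have hND : N < D := by linarith
  have b1 : 0 < N / D := by positivity
  have b2 : N / D < 1 := (div_lt_one hD).2 hND
  have b3 : 0 < N' / D := by positivity
  have b4 : N' / D < 1 := (div_lt_one hD).2 h2
  refine ⟨by linarith, by linarith, by linarith, by linarith, ?_⟩
  simp only [_root_.sub_sub_cancel]
  have c1 : a / d ≤ N' / D := by
    rw [div_le_div_iff₀ hd hD]; nlinarith
  have c2 : τ / d / n ≤ 1 - N / D := by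
    rw [one_sub_div hD.ne', div_div]
    gcongr
  have c3 : N' / D / (N / D) ≤ d / (d + κ) := by
    rw [div_div_div_cancel_right₀ hD.ne', div_le_div_iff₀ hN (by positivity)]
    nlinarith [mul_le_mul_of_nonneg_left h4 hd.le, mul_le_mul_of_nonneg_left
      (h2.le.trans h3) hκ.le]
  obtain ⟨e0, e1⟩ := phiFun_div_le hs hs' (by positivity : 0 < a / d) b1 b2
    (by positivity : 0 < τ / d / n) c2 c1 b4
  refine le_trans ?_ hn
  have e2 : W * (τ / d / n) ^ (-s) = W * (τ / d) ^ (-s) * (n : ℝ) ^ s := by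
    rw [Real.div_rpow (by positivity) hnr.le, Real.rpow_neg hnr.le s, div_inv_eq_mul]; ring
  rw [e2] at e1
  calc _ ≤ (W * (τ / d) ^ (-s) * (n : ℝ) ^ s) ^ ((1:ℝ)/2) * (n : ℝ) ^ k *
        (d / (d + κ)) ^ ((n : ℝ) / 2) := by gcongr
    _ = _ := by
      rw [Real.mul_rpow (by positivity) (by positivity), ← Real.rpow_mul hnr.le,
        Real.rpow_add hnr, mul_one_div]
      ring

/-- The ratio vanishes when `γ` strictly contains `T` and the residuals are close. -/
lemma eventually_ratio_le_of_bounded_gap {s s' k a d l L δ : ℝ} (hs : 0 < s) (hs' : 0 < s')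
    (hk : k < 0) (ha : 0 < a) (hd : 0 < d) (hl : 0 < l) (hL : 0 ≤ L) (hδ : 0 < δ) :
    ∀ᶠ n : ℕ in atTop, ∀ D N N' : ℝ, a * n ≤ N' → N' < D → D ≤ d * n → a * n ≤ N →
      N' - N ≤ L → l * n ≤ D - N →
      0 < 1 - N / D ∧ 1 - N / D < 1 ∧ 0 < 1 - N' / D ∧ 1 - N' / D < 1 ∧
      (phiFun s (1 - (1 - N / D)) / phiFun s' (1 - (1 - N' / D))) ^ ((1:ℝ)/2) * (n : ℝ) ^ k *
        ((1 - (1 - N' / D)) / (1 - (1 - N / D))) ^ ((n : ℝ) / 2) ≤ δ := by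
  set W : ℝ := s ^ (s - 1) * Real.exp (-s) /
    (s' ^ (s' - 1) * Real.exp (-s') * (a / d) ^ (1 + s')) with hW
  have hlim : Tendsto (fun n : ℕ => (W * (l / d) ^ (-s)) ^ ((1:ℝ)/2) * (n : ℝ) ^ k *
      Real.exp (L / a / 2)) atTop (nhds 0) := by
    have h := (((tendsto_rpow_neg_atTop (neg_pos.2 hk)).comp
      tendsto_natCast_atTop_atTop).const_mul ((W * (l / d) ^ (-s)) ^ ((1:ℝ)/2))).mul_const
      (Real.exp (L / a / 2))
    simpa [Function.comp_def] using h
  filter_upwards [hlim.eventually_le_const hδ, eventually_gt_atTop 0] with n hn hn0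
    D N N' h1 h2 h3 h4 h5 h6
  have hnr : (0 : ℝ) < n := by exact_mod_cast hn0
  have hN' : 0 < N' := lt_of_lt_of_le (by positivity) h1
  have hD : 0 < D := hN'.trans h2
  have hN : 0 < N := lt_of_lt_of_le (by positivity) h4
  have hND : N < D := by have : 0 < l * n := by positivity
                         linarith
  have b1 : 0 < N / D := by positivity
  have b2 : N / D < 1 := (div_lt_one hD).2 hND
  have b3 : 0 < N' / D := by positivity
  have b4 : N' / D < 1 := (div_lt_one hD).2 h2
  refine ⟨by linarith, by linarith, by linarith, by linarith, ?_⟩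
  simp only [_root_.sub_sub_cancel]
  have c1 : a / d ≤ N' / D := by
    rw [div_le_div_iff₀ hd hD]; nlinarith
  have c2 : l / d ≤ 1 - N / D := by
    rw [one_sub_div hD.ne', div_le_div_iff₀ hd hD]; nlinarith
  have c3 : N' / D / (N / D) ≤ Real.exp (L / a / n) := by
    refine le_trans ?_ (Real.add_one_le_exp _)
    rw [div_div_div_cancel_right₀ hD.ne', div_le_iff₀ hN, div_div]
    have : L ≤ L / (a * n) * N := by
      rw [div_mul_eq_mul_div, le_div_iff₀ (by positivity)]
      exact mul_le_mul_of_nonneg_left h4 hL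
    linarith
  obtain ⟨e0, e1⟩ := phiFun_div_le hs hs' (by positivity : 0 < a / d) b1 b2
    (by positivity : 0 < l / d) c2 c1 b4
  refine le_trans ?_ hn
  have e3 : Real.exp (L / a / n) ^ ((n : ℝ) / 2) = Real.exp (L / a / 2) := by
    rw [← Real.exp_mul]; congr 1; field_simp
  rw [← e3]
  gcongr

end Asymptotics

section GoodEvent
variable {Ω : Type*} [MeasurableSpace Ω] {P : Measure Ω} [IsProbabilityMeasure P]

/-- With probability close to one, all the noise terms entering `R_γ²` and `R_T²` are controlled,
and the noise in a given direction stays away from a given value. -/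
lemma exists_eventually_noise_bounds {ε : (n : ℕ) → Ω → Fin n → ℝ}
    (hmeas : ∀ n, Measurable (ε n))
    (hsph : ∀ (n : ℕ) (O : Matrix (Fin n) (Fin n) ℝ), Oᵀ * O = 1 →
      P.map (fun ω => O.mulVec (ε n ω)) = P.map (ε n))
    (hcov : ∀ n i j, ∫ ω, ε n ω i * ε n ω j ∂P = if i = j then 1 else 0)
    (hA1 : ∀ c : ℝ, 0 < c → ∃ M : ℝ, 1 < M ∧ ∀ n : ℕ, 0 < n →
      ENNReal.ofReal (1 - c) <
        P {ω | M⁻¹ < (∑ i, ε n ω i ^ 2) / n ∧ (∑ i, ε n ω i ^ 2) / n < M})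
    {c q : ℝ} (hc : 0 < c) (hq : 0 < q) :
    ∃ M > 0, ∃ K > 0, ∃ t > 0, ∀ L > 0, ∀ θ > 0,
      ∀ (b g u : (n : ℕ) → Fin n → ℝ) (a : ℕ → ℝ) (A A' : (n : ℕ) → Matrix (Fin n) (Fin n) ℝ),
      (∀ᶠ n : ℕ in atTop, b n ⬝ᵥ b n ≤ L * n) → (∀ᶠ n : ℕ in atTop, g n ⬝ᵥ g n ≤ L * n) →
      (∀ᶠ n in atTop, u n ⬝ᵥ u n = 1) →
      (∀ᶠ n in atTop, ∑ i, ∑ j, A n i j ^ 2 ≤ q) → (∀ᶠ n in atTop, ∑ i, ∑ j, A' n i j ^ 2 ≤ q) →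
      ∀ᶠ n : ℕ in atTop, 1 - c ≤ P.real {ω | (M⁻¹ < (∑ i, ε n ω i ^ 2) / n ∧
        (∑ i, ε n ω i ^ 2) / n < M) ∧ (∑ i, ε n ω i) ^ 2 < θ * n ^ 2 ∧
        ∑ i, (A n *ᵥ ε n ω) i ^ 2 < K ∧ ∑ i, (A' n *ᵥ ε n ω) i ^ 2 < K ∧
        (b n ⬝ᵥ ε n ω) ^ 2 < (θ * n) ^ 2 ∧ (g n ⬝ᵥ ε n ω) ^ 2 < (θ * n) ^ 2 ∧
        t < |u n ⬝ᵥ ε n ω - a n|} := by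
  set c' := c / 6 with hc'
  have hc0' : 0 < c' := by positivity
  obtain ⟨M, hM1, hM⟩ := hA1 c' hc0'
  have hM0 : 0 < M := by linarith
  refine ⟨M, hM0, q / c', by positivity, c' / (8 * M), by positivity, ?_⟩
  intro L hL θ hθ b g u a A A' hb hg hu hA hA'
  have hlim : Tendsto (fun n : ℕ => (1 / θ + 2 * (L / θ ^ 2) + 2 * M) / (n : ℝ)) atTop (nhds 0) :=
    tendsto_const_div_atTop_nhds_zero_nat _
  filter_upwards [hb, hg, hu, hA, hA', hlim.eventually_le_const hc0', eventually_gt_atTop 0]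
    with n hb hg hu hA hA' hn hn0
  have hnr : (0 : ℝ) < n := by exact_mod_cast hn0
  set B1 := {ω | ¬ (M⁻¹ < (∑ i, ε n ω i ^ 2) / n ∧ (∑ i, ε n ω i ^ 2) / n < M)} with hB1
  set B2 := {ω | θ * n ^ 2 ≤ ((1 : Fin n → ℝ) ⬝ᵥ ε n ω) ^ 2} with hB2
  set B3 := {ω | q / c' ≤ ∑ i, (A n *ᵥ ε n ω) i ^ 2} with hB3
  set B4 := {ω | q / c' ≤ ∑ i, (A' n *ᵥ ε n ω) i ^ 2} with hB4
  set B5 := {ω | (θ * n) ^ 2 ≤ (b n ⬝ᵥ ε n ω) ^ 2} with hB5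
  set B6 := {ω | (θ * n) ^ 2 ≤ (g n ⬝ᵥ ε n ω) ^ 2} with hB6
  set B7 := {ω | |u n ⬝ᵥ ε n ω - a n| ≤ c' / (8 * M)} with hB7
  have p1 : P.real B1 ≤ c' := by
    have hm : MeasurableSet {ω | M⁻¹ < (∑ i, ε n ω i ^ 2) / n ∧ (∑ i, ε n ω i ^ 2) / n < M} := by
      have hs : Measurable fun ω => (∑ i, ε n ω i ^ 2) / (n : ℝ) := by
        have := hmeas n
        fun_prop
      have h1 : MeasurableSet {ω | M⁻¹ < (∑ i, ε n ω i ^ 2) / n} :=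
        measurableSet_lt measurable_const hs
      have h2 : MeasurableSet {ω | (∑ i, ε n ω i ^ 2) / n < M} :=
        measurableSet_lt hs measurable_const
      exact h1.inter h2
    have h1 := (ENNReal.ofReal_le_iff_le_toReal (measure_ne_top _ _)).1 (hM n hn0).le
    have h2 : P.real B1 = 1 - P.real
      {ω | M⁻¹ < (∑ i, ε n ω i ^ 2) / n ∧ (∑ i, ε n ω i ^ 2) / n < M} :=
      probReal_compl_eq_one_sub hm
    rw [h2, measureReal_def]
    linarith
  have p2 : P.real B2 ≤ 1 / θ / n := by
    refine (measureReal_le_dotProduct_sq (hmeas n) (hcov n) 1 (by positivity)).trans_eq ?_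
    simp [dotProduct]
    field_simp
  have pA : ∀ A : Matrix (Fin n) (Fin n) ℝ, ∑ i, ∑ j, A i j ^ 2 ≤ q →
      P.real {ω | q / c' ≤ ∑ i, (A *ᵥ ε n ω) i ^ 2} ≤ c' := fun A hA => by
    refine (measureReal_le_sum_mulVec_sq (hmeas n) (hcov n) A (by positivity)).trans ?_
    rw [div_le_iff₀ (by positivity), mul_div_cancel₀ _ hc0'.ne']
    exact hA
  have pb : ∀ b : Fin n → ℝ, b ⬝ᵥ b ≤ L * n →
      P.real {ω | (θ * n) ^ 2 ≤ (b ⬝ᵥ ε n ω) ^ 2} ≤ L / θ ^ 2 / n := fun b hb => by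
    refine (measureReal_le_dotProduct_sq (hmeas n) (hcov n) b (by positivity)).trans ?_
    rw [div_le_iff₀ (by positivity)]
    refine hb.trans_eq ?_
    field_simp
  have p7 : P.real B7 ≤ c' + 2 * M / n + c' := by
    refine (measureReal_abs_dotProduct_sub_le (hmeas n) (hsph n) (hcov n) hn0 hu (a n)
      (by positivity) hM0).trans ?_
    have h1 : P.real {ω | ¬ M⁻¹ < (∑ j, ε n ω j ^ 2) / n} ≤ P.real B1 :=
      measureReal_mono fun ω hω h => hω h.1
    have h2 : 8 * M * (c' / (8 * M)) = c' := by field_simp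
    linarith
  set S := {ω | (M⁻¹ < (∑ i, ε n ω i ^ 2) / n ∧
        (∑ i, ε n ω i ^ 2) / n < M) ∧ (∑ i, ε n ω i) ^ 2 < θ * n ^ 2 ∧
        ∑ i, (A n *ᵥ ε n ω) i ^ 2 < q / c' ∧ ∑ i, (A' n *ᵥ ε n ω) i ^ 2 < q / c' ∧
        (b n ⬝ᵥ ε n ω) ^ 2 < (θ * n) ^ 2 ∧ (g n ⬝ᵥ ε n ω) ^ 2 < (θ * n) ^ 2 ∧
        c' / (8 * M) < |u n ⬝ᵥ ε n ω - a n|} with hS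
  have hcover : Set.univ ⊆ S ∪ (B1 ∪ (B2 ∪ (B3 ∪ (B4 ∪ (B5 ∪ (B6 ∪ B7)))))) := by
    intro ω _
    by_contra hcon
    simp only [Set.mem_union, not_or] at hcon
    obtain ⟨h, h1, h2, h3, h4, h5, h6, h7⟩ := hcon
    refine h ⟨not_not.1 h1, ?_, not_le.1 h3, not_le.1 h4, not_le.1 h5, not_le.1 h6, not_le.1 h7⟩
    have : ((1 : Fin n → ℝ) ⬝ᵥ ε n ω) ^ 2 < θ * n ^ 2 := not_le.1 h2
    simpa [dotProduct] using this
  have htot := measureReal_mono (μ := P) hcover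
  rw [probReal_univ] at htot
  have u1 := measureReal_union_le (μ := P) S (B1 ∪ (B2 ∪ (B3 ∪ (B4 ∪ (B5 ∪ (B6 ∪ B7))))))
  have u2 := measureReal_union_le (μ := P) B1 (B2 ∪ (B3 ∪ (B4 ∪ (B5 ∪ (B6 ∪ B7)))))
  have u3 := measureReal_union_le (μ := P) B2 (B3 ∪ (B4 ∪ (B5 ∪ (B6 ∪ B7))))
  have u4 := measureReal_union_le (μ := P) B3 (B4 ∪ (B5 ∪ (B6 ∪ B7)))
  have u5 := measureReal_union_le (μ := P) B4 (B5 ∪ (B6 ∪ B7))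
  have u6 := measureReal_union_le (μ := P) B5 (B6 ∪ B7)
  have u7 := measureReal_union_le (μ := P) B6 B7
  have p3 := pA _ hA
  have p4 := pA _ hA'
  have p5 := pb _ hb
  have p6 := pb _ hg
  have hn' : 1 / θ / n + L / θ ^ 2 / n + L / θ ^ 2 / n + 2 * M / n ≤ c' := by
    refine le_of_eq_of_le ?_ hn
    ring
  have : c = 6 * c' := by rw [hc']; ring
  linarith

/-- Lower bounds on probabilities for every tolerance give convergence to one. -/
lemma tendsto_measure_one_of_eventually {S : ℕ → Set Ω}
    (h : ∀ c > 0, ∀ᶠ n in atTop, 1 - c ≤ P.real (S n)) :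
    Tendsto (fun n => P (S n)) atTop (nhds 1) := by
  have h1 : Tendsto (fun n => P.real (S n)) atTop (nhds 1) := by
    refine Metric.tendsto_nhds.2 fun c hc => ?_
    filter_upwards [h (c / 2) (by positivity)] with n hn
    rw [Real.dist_eq, abs_lt]
    constructor <;> linarith [measureReal_le_one (μ := P) (s := S n)]
  have h2 := ENNReal.tendsto_ofReal h1
  simpa using h2

end GoodEvent

section Deterministic
variable {n p : ℕ} {X : Matrix (Fin n) (Fin p) ℝ} {γ T : Finset (Fin p)}

lemma dotProduct_sq_le {ι : Type*} [Fintype ι] (x y : ι → ℝ) :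
    (x ⬝ᵥ y) ^ 2 ≤ (x ⬝ᵥ x) * (y ⬝ᵥ y) := by
  simpa [dotProduct, sq] using Finset.sum_mul_sq_le_sq_mul_sq Finset.univ x y

lemma sub_hatMatrix_dotProduct_self (h : IsUnit ((designSub X γ)ᵀ * designSub X γ).det)
    (b : Fin n → ℝ) :
    (b - hatMatrix X γ *ᵥ b) ⬝ᵥ (b - hatMatrix X γ *ᵥ b) =
      b ⬝ᵥ b - hatMatrix X γ *ᵥ b ⬝ᵥ hatMatrix X γ *ᵥ b := by
  have h1 := hatMatrix_mulVec_dotProduct_self h b b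
  simp only [sub_dotProduct, dotProduct_sub, h1, dotProduct_comm b (hatMatrix X γ *ᵥ b)]
  ring

lemma hatMatrix_mulVec_dotProduct_self_le (h : IsUnit ((designSub X γ)ᵀ * designSub X γ).det)
    (b : Fin n → ℝ) : hatMatrix X γ *ᵥ b ⬝ᵥ hatMatrix X γ *ᵥ b ≤ b ⬝ᵥ b := by
  have h1 := sub_hatMatrix_dotProduct_self h b
  have h2 : 0 ≤ (b - hatMatrix X γ *ᵥ b) ⬝ᵥ (b - hatMatrix X γ *ᵥ b) :=
    Finset.sum_nonneg fun i _ => mul_self_nonneg _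
  linarith

/-- A submodel missing an active coefficient leaves a residual of linear order. -/
lemma le_residual_of_missing (h : IsUnit ((designSub X γ)ᵀ * designSub X γ).det) {c : ℝ}
    (hc : 0 ≤ c) (hX : ∀ β : Fin p → ℝ, c * (β ⬝ᵥ β) ≤ X *ᵥ β ⬝ᵥ X *ᵥ β)
    (β : Fin p → ℝ) {j : Fin p} (hj : j ∉ γ) :
    c * β j ^ 2 ≤ X *ᵥ β ⬝ᵥ X *ᵥ β -
      hatMatrix X γ *ᵥ (X *ᵥ β) ⬝ᵥ hatMatrix X γ *ᵥ (X *ᵥ β) := by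
  rw [← sub_hatMatrix_dotProduct_self h]
  obtain ⟨β', hβ', he⟩ := exists_hatMatrix_mulVec_eq (X := X) (γ := γ) (X *ᵥ β)
  rw [he, ← mulVec_sub]
  refine le_trans (mul_le_mul_of_nonneg_left ?_ hc) (hX _)
  have := Finset.single_le_sum (f := fun k => (β - β') k * (β - β') k)
    (fun k _ => mul_self_nonneg _) (Finset.mem_univ j)
  simpa [hβ' j hj, sq, dotProduct] using this

/-- The explained sum of squares dominates the squared component along a unit vector in the
column space. -/
lemma sq_dotProduct_le_explained (h : IsUnit ((designSub X γ)ᵀ * designSub X γ).det)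
    {u : Fin n → ℝ} (hu : u ⬝ᵥ u = 1) (hHu : hatMatrix X γ *ᵥ u = u) (b e : Fin n → ℝ) (σ : ℝ) :
    (u ⬝ᵥ b + σ * (u ⬝ᵥ e)) ^ 2 ≤ hatMatrix X γ *ᵥ b ⬝ᵥ hatMatrix X γ *ᵥ b +
      2 * σ * (hatMatrix X γ *ᵥ b ⬝ᵥ e) +
      σ ^ 2 * (hatMatrix X γ *ᵥ e ⬝ᵥ hatMatrix X γ *ᵥ e) := by
  have h1 := dotProduct_sq_le u (hatMatrix X γ *ᵥ b + σ • hatMatrix X γ *ᵥ e)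
  have h2 : ∀ x, u ⬝ᵥ hatMatrix X γ *ᵥ x = u ⬝ᵥ x := fun x => by
    rw [dotProduct_hatMatrix_mulVec, hHu]
  have h3 := hatMatrix_mulVec_dotProduct_self h b e
  rw [hu, one_mul] at h1
  simp only [add_dotProduct, dotProduct_add, smul_dotProduct, dotProduct_smul, smul_eq_mul, h2,
    dotProduct_comm (hatMatrix X γ *ᵥ e) (hatMatrix X γ *ᵥ b), h3] at h1
  linarith

end Deterministic

/-- **Corollary, consistency of the Laplace-approximated Bayes factor.**
For nonempty `T ≠ γ` and `ν < 1`, the ratio of Laplace-approximated Bayes factors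
tends to `0` in probability. -/
theorem laplace_bayesFactor_consistency
    (p : ℕ) (hp : 1 ≤ p)
    (Ω : Type) [MeasurableSpace Ω] (P : Measure Ω) [IsProbabilityMeasure P]
    (X : (n : ℕ) → Matrix (Fin n) (Fin p) ℝ)
    (ε : (n : ℕ) → Ω → Fin n → ℝ)
    (horth : ∀ n j, ∑ i, X n i j = 0)
    (hA2 : ∃ S₀ : Matrix (Fin p) (Fin p) ℝ, S₀.PosDef ∧
      Tendsto (fun n : ℕ => ((n : ℝ)⁻¹) • ((X n)ᵀ * X n)) atTop (nhds S₀))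
    (hmeas : ∀ n, Measurable (ε n))
    (hsph : ∀ (n : ℕ) (O : Matrix (Fin n) (Fin n) ℝ), Oᵀ * O = 1 →
      P.map (fun ω => O.mulVec (ε n ω)) = P.map (ε n))
    (hmean : ∀ n i, ∫ ω, ε n ω i ∂P = 0)
    (hcov : ∀ n i j, ∫ ω, ε n ω i * ε n ω j ∂P = if i = j then 1 else 0)
    (hA1 : ∀ c : ℝ, 0 < c → ∃ M : ℝ, 1 < M ∧ ∀ n : ℕ, 0 < n →
      ENNReal.ofReal (1 - c) <
        P {ω | M⁻¹ < (∑ i, ε n ω i ^ 2) / n ∧ (∑ i, ε n ω i ^ 2) / n < M})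
    (T : Finset (Fin p)) (αT σT : ℝ) (hσ : 0 < σT)
    (βT : Fin p → ℝ) (hβT : ∀ j ∈ T, βT j ≠ 0) (hβT' : ∀ j ∉ T, βT j = 0)
    (hT : T.Nonempty) (γ : Finset (Fin p)) (hγ : γ.Nonempty) (hγT : γ ≠ T)
    (ν : ℝ) (hν : ν < 1)
    :
    (∀ δ : ℝ, 0 < δ →
      Tendsto (fun n : ℕ =>
        P {ω | 0 < RsqC (X n) γ (yResp (X n) αT βT σT (ε n ω)) ∧ RsqC (X n) γ (yResp (X n) αT βT σT (ε n ω)) < 1 ∧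
               0 < RsqC (X n) T (yResp (X n) αT βT σT (ε n ω)) ∧ RsqC (X n) T (yResp (X n) αT βT σT (ε n ω)) < 1 ∧
               (phiFun ((γ.card : ℝ) - ν) (1 - RsqC (X n) γ (yResp (X n) αT βT σT (ε n ω))) /
                   phiFun ((T.card : ℝ) - ν) (1 - RsqC (X n) T (yResp (X n) αT βT σT (ε n ω)))) ^ ((1:ℝ)/2) *
                 (n : ℝ) ^ (((T.card : ℝ) - γ.card) / 2) *
                 ((1 - RsqC (X n) T (yResp (X n) αT βT σT (ε n ω))) / (1 - RsqC (X n) γ (yResp (X n) αT βT σT (ε n ω)))) ^ ((n : ℝ) / 2)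
                 ≤ δ})
        atTop (nhds 1)) := by

  intro δ hδ
  refine tendsto_measure_one_of_eventually fun c hc => ?_
  obtain ⟨S, hS, hXS⟩ := hA2
  obtain ⟨l, hl, hgram⟩ := eventually_gram_lower_bound hS hXS
  obtain ⟨j₀, hj₀⟩ := hγ
  obtain ⟨j, hjT, hjγ⟩ : ∃ j ∈ T, j ∉ γ ∨ T ⊆ γ := by
    by_cases h : T ⊆ γ
    · exact hT.imp fun j hj => ⟨hj, Or.inr h⟩
    · obtain ⟨j, hj, hj'⟩ := Finset.not_subset.1 h
      exact ⟨j, hj, Or.inl hj'⟩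
  set κ := l * βT j ^ 2 with hκ
  have hκ0 : 0 < κ := by have := hβT j hjT; positivity
  have hcard : ∀ s : Finset (Fin p), s.Nonempty → 0 < (s.card : ℝ) - ν := fun s hs => by
    have : (1 : ℝ) ≤ s.card := by exact_mod_cast hs.card_pos
    linarith
  set L := |βT ⬝ᵥ S *ᵥ βT| + 1 with hL
  have hL0 : 0 < L := by positivity
  obtain ⟨M, hM, K, hK, t, ht, hgood⟩ := exists_eventually_noise_bounds hmeas hsph hcov hA1 hc
    (show (0 : ℝ) < p by exact_mod_cast hp)
  set θ := min (1 / (4 * M)) (κ / (2 * (4 * σT + σT ^ 2))) with hθ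
  have hθ0 : 0 < θ := by positivity
  have hθ1 : σT ^ 2 * (θ + θ) ≤ σT ^ 2 / (2 * M) := by
    have h1 : θ ≤ 1 / (4 * M) := min_le_left _ _
    have h2 : 1 / (4 * M) + 1 / (4 * M) = 1 / (2 * M) := by field_simp; ring
    rw [div_eq_mul_one_div (σT ^ 2)]
    exact mul_le_mul_of_nonneg_left (by linarith) (by positivity)
  have hθ2 : 4 * σT * θ + σT ^ 2 * θ ≤ κ / 2 := by
    have h1 : θ ≤ κ / (2 * (4 * σT + σT ^ 2)) := min_le_right _ _
    rw [le_div_iff₀ (by positivity)] at h1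
    linarith
  set b : (n : ℕ) → Fin n → ℝ := fun n => X n *ᵥ βT with hb
  set x : (n : ℕ) → Fin n → ℝ := fun n => X n *ᵥ Pi.single j₀ 1 with hx
  set u : (n : ℕ) → Fin n → ℝ := fun n => (√(x n ⬝ᵥ x n))⁻¹ • x n with hu
  have hunit : ∀ᶠ n in atTop, ∀ s : Finset (Fin p),
      IsUnit ((designSub (X n) s)ᵀ * designSub (X n) s).det := by
    filter_upwards [hgram, eventually_gt_atTop 0] with n hn hn0 s
    exact isUnit_det_gram_designSub (mul_pos hl (by exact_mod_cast hn0)) hn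
  have hbL : ∀ᶠ n : ℕ in atTop, b n ⬝ᵥ b n ≤ L * n := by
    filter_upwards [(tendsto_gram_form hXS βT).eventually_le_const
      (lt_of_le_of_lt (le_abs_self _) (lt_add_one _)), eventually_gt_atTop 0] with n hn hn0
    exact (div_le_iff₀ (by exact_mod_cast hn0)).1 hn
  have hgL : ∀ᶠ n : ℕ in atTop,
      hatMatrix (X n) γ *ᵥ b n ⬝ᵥ hatMatrix (X n) γ *ᵥ b n ≤ L * n := by
    filter_upwards [hbL, hunit] with n hn hun
    exact (hatMatrix_mulVec_dotProduct_self_le (hun γ) _).trans hn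
  have huu : ∀ᶠ n in atTop, u n ⬝ᵥ u n = 1 := by
    filter_upwards [hgram, eventually_gt_atTop 0] with n hn hn0
    have h1 := hn (Pi.single j₀ 1)
    have hpos : 0 < x n ⬝ᵥ x n := by
      refine lt_of_lt_of_le ?_ h1
      have : (0 : ℝ) < n := by exact_mod_cast hn0
      simp
      positivity
    simp only [hu, smul_dotProduct, dotProduct_smul, smul_eq_mul]
    rw [← mul_assoc, ← mul_inv, Real.mul_self_sqrt hpos.le, inv_mul_cancel₀ hpos.ne']
  have hfro : ∀ s : Finset (Fin p),
      ∀ᶠ n in atTop, ∑ i, ∑ j, hatMatrix (X n) s i j ^ 2 ≤ (p : ℝ) := fun s => by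
    filter_upwards [hunit] with n hun
    rw [sum_hatMatrix_sq (hun s)]
    exact_mod_cast (Finset.card_le_univ s).trans (by simp)
  have hlarge : ∀ᶠ n : ℕ in atTop, K ≤ θ * n :=
    (tendsto_natCast_atTop_atTop.const_mul_atTop hθ0).eventually_ge_atTop K
  have hevent := hgood L hL0 θ hθ0 b (fun n => hatMatrix (X n) γ *ᵥ b n) u
    (fun n => -(u n ⬝ᵥ b n) / σT) (fun n => hatMatrix (X n) γ) (fun n => hatMatrix (X n) T)
    hbL hgL huu (hfro γ) (hfro T)
  set d := L + 2 * σT * θ + σT ^ 2 * M with hd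
  have hd0 : 0 < d := by positivity
  have ha0 : 0 < σT ^ 2 / (2 * M) := by positivity
  have hlin := eventually_ratio_le_of_linear_gap (k := ((T.card : ℝ) - γ.card) / 2)
    (hcard γ ⟨j₀, hj₀⟩) (hcard T hT) ha0 hd0 (half_pos hκ0) (by positivity : 0 < (σT * t) ^ 2) hδ
  have hbdd := fun h : T ⊆ γ => eventually_ratio_le_of_bounded_gap
    (k := ((T.card : ℝ) - γ.card) / 2) (hcard γ ⟨j₀, hj₀⟩) (hcard T hT)
    (by
      have : (T.card : ℝ) < γ.card := by
        exact_mod_cast Finset.card_lt_card (h.ssubset_of_ne hγT.symm)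
      linarith) ha0 hd0 (half_pos hκ0) (by positivity : 0 ≤ σT ^ 2 * K) hδ
  have hbdd' := eventually_imp_distrib_left.2 hbdd
  filter_upwards [hevent, hgram, hunit, hbL, huu, hlarge, hlin, hbdd', eventually_gt_atTop 0]
    with n hevent hgram hunit hbL huu hlarge hlin hbdd hn0
  have hnr : (0 : ℝ) < n := by exact_mod_cast hn0
  refine hevent.trans (measureReal_mono ?_)
  rintro ω ⟨⟨hE1, hE2⟩, hm, hCγ, hCT, hB, hBγ, hut⟩
  have hHT : hatMatrix (X n) T *ᵥ (X n *ᵥ βT) = X n *ᵥ βT :=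
    hatMatrix_mulVec_of_support (hunit T) hβT'
  rw [Set.mem_ofPred_eq, RsqC_yResp hn0 (horth n) (hunit γ), RsqC_yResp hn0 (horth n) (hunit T),
    hHT]
  have hAγ := hatMatrix_mulVec_dotProduct_self_le (hunit γ) (b n)
  have hAlow : κ * n ≤ b n ⬝ᵥ b n := by
    refine le_trans ?_ (hgram βT)
    have := Finset.single_le_sum (f := fun k => βT k * βT k)
      (fun k _ => mul_self_nonneg _) (Finset.mem_univ j)
    have h2 : βT j ^ 2 ≤ βT ⬝ᵥ βT := by simpa [sq, dotProduct] using this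
    calc κ * n = l * n * βT j ^ 2 := by rw [hκ]; ring
      _ ≤ _ := by gcongr
  have hgap : j ∉ γ → κ * n ≤ b n ⬝ᵥ b n -
      hatMatrix (X n) γ *ᵥ b n ⬝ᵥ hatMatrix (X n) γ *ᵥ b n := fun hj => by
    have := le_residual_of_missing (hunit γ) (mul_nonneg hl.le hnr.le) hgram βT hj
    rw [hκ]
    linarith
  have hHγ : T ⊆ γ → hatMatrix (X n) γ *ᵥ b n = b n := fun h =>
    hatMatrix_mulVec_of_support (hunit γ) fun k hk => hβT' k fun hkT => hk (h hkT)
  have hHu : hatMatrix (X n) γ *ᵥ u n = u n := by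
    simp only [hu, mulVec_smul]
    congr 1
    refine hatMatrix_mulVec_of_support (hunit γ) fun k hk => ?_
    rw [Pi.single_eq_of_ne]
    rintro rfl
    exact hk hj₀
  have hexp := sq_dotProduct_le_explained (hunit γ) huu hHu (b n) (ε n ω) σT
  have hexp' : (σT * t) ^ 2 ≤ (u n ⬝ᵥ b n + σT * (u n ⬝ᵥ ε n ω)) ^ 2 := by
    have h1 : u n ⬝ᵥ b n + σT * (u n ⬝ᵥ ε n ω) =
        σT * (u n ⬝ᵥ ε n ω - -(u n ⬝ᵥ b n) / σT) := by field_simp; ring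
    rw [h1, mul_pow, mul_pow, ← sq_abs (_ - _)]
    gcongr
  have hsq : ∀ y : Fin n → ℝ, ∑ i, y i ^ 2 = y ⬝ᵥ y := fun y => by simp [dotProduct, sq]
  have hnn : ∀ y : Fin n → ℝ, 0 ≤ y ⬝ᵥ y := fun y =>
    Finset.sum_nonneg fun i _ => mul_self_nonneg _
  rw [hsq] at hCγ hCT hE1 hE2
  have hCγ0 := hnn (hatMatrix (X n) γ *ᵥ ε n ω)
  have hCT0 := hnn (hatMatrix (X n) T *ᵥ ε n ω)
  have hθn : 0 ≤ θ * n := by positivity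
  obtain ⟨hB1, hB2⟩ := abs_lt.1 (abs_lt_of_sq_lt_sq hB hθn)
  obtain ⟨hBγ1, hBγ2⟩ := abs_lt.1 (abs_lt_of_sq_lt_sq hBγ hθn)
  rw [lt_div_iff₀ hnr] at hE1
  rw [div_lt_iff₀ hnr] at hE2
  have hm0 : 0 ≤ (∑ i, ε n ω i) ^ 2 / n := by positivity
  have hm1 : (∑ i, ε n ω i) ^ 2 / n < θ * n := by
    rw [div_lt_iff₀ hnr]; linarith
  change _ ∧ _
  have hbn : b n = X n *ᵥ βT := rfl
  simp only [← hbn]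
  clear_value d b u x θ κ
  generalize (∑ i, ε n ω i) ^ 2 / n = m at *
  generalize ε n ω ⬝ᵥ ε n ω = E at *
  generalize hatMatrix (X n) γ *ᵥ ε n ω ⬝ᵥ hatMatrix (X n) γ *ᵥ ε n ω = Cγ at *
  generalize hatMatrix (X n) T *ᵥ ε n ω ⬝ᵥ hatMatrix (X n) T *ᵥ ε n ω = CT at *
  have hσ2 : 0 < σT ^ 2 := by positivity
  have hσE1 := mul_lt_mul_of_pos_left hE1 hσ2
  have hσE2 := mul_lt_mul_of_pos_left hE2 hσ2
  have hσm0 := mul_le_mul_of_nonneg_left hm0 hσ2.le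
  have hσm1 := mul_lt_mul_of_pos_left hm1 hσ2
  have hσCγ := mul_lt_mul_of_pos_left hCγ hσ2
  have hσCT := mul_lt_mul_of_pos_left hCT hσ2
  have hσK := mul_le_mul_of_nonneg_left hlarge hσ2.le
  have hσCγ0 := mul_nonneg hσ2.le hCγ0
  have hσCT0 := mul_nonneg hσ2.le hCT0
  have hσB1 := mul_lt_mul_of_pos_left hB1 hσ
  have hσB2 := mul_lt_mul_of_pos_left hB2 hσ
  have hσBγ1 := mul_lt_mul_of_pos_left hBγ1 hσ
  have hσBγ2 := mul_lt_mul_of_pos_left hBγ2 hσ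
  have hθ1n := mul_le_mul_of_nonneg_right hθ1 hnr.le
  have hθ2n := mul_le_mul_of_nonneg_right hθ2 hnr.le
  have hσθn : 0 < σT * (θ * n) := by positivity
  have hσθn' : 0 < σT ^ 2 * (θ * n) := by positivity
  have hMn : σT ^ 2 * (M⁻¹ * n) = 2 * (σT ^ 2 / (2 * M) * n) := by field_simp
  have hκn : 0 < κ * n := by positivity
  have hdn : d * n = L * n + 2 * (σT * (θ * n)) + σT ^ 2 * (M * n) := by rw [hd]; ring
  rcases hjγ with hj | h
  · have hgap := hgap hj
    refine hlin _ _ _ ?_ ?_ ?_ ?_ ?_ <;> linarith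
  · rw [hHγ h] at hσBγ1 hσBγ2 ⊢
    refine hbdd h _ _ _ ?_ ?_ ?_ ?_ ?_ ?_ <;> linarith
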